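/- For every k ∈ ℝ with cos k ∉ {−1, 1} and every j ∈ {0,1,2}, l ∈ {0,1}, one has 4cos²(ξ_j(k)) ≠ 1, the function x_{j,l} is differentiable at k, and its derivative satisfies dx_{j,l}(k)/dk = −(−1)^l · (A/21) · F(cos(ξ_j(k))) · √(1 − (28/27)cos²(ξ_j(k))), where F(x) = −2x(28x² + 33)/(9(4x² − 1)³). -/

import Mathlib

noncomputable section

/-- The constant `A = 9√3/(7√7)`. -/
def Aconst : ℝ := 9 * Real.sqrt 3 / (7 * Real.sqrt 7)

/-- `ξ_j(k) = (1/3)·arccos(A·cos k) + 2jπ/3`. -/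
def xi (j : ℕ) (k : ℝ) : ℝ :=
  (1 / 3) * Real.arccos (Aconst * Real.cos k) + 2 * j * Real.pi / 3

/-- `λ_j(k) = (2√7/(3√3))·cos(ξ_j(k))`, the three roots of `9λ³ − 7λ − 2cos k = 0`. -/
def lam (j : ℕ) (k : ℝ) : ℝ :=
  (2 * Real.sqrt 7 / (3 * Real.sqrt 3)) * Real.cos (xi j k)

/-- `x_{j,l}(k) = (−1)^l · λ_j'(k)/√(1 − λ_j(k)²)`. -/
def xfun (j l : ℕ) (k : ℝ) : ℝ :=
  (-1) ^ l * deriv (lam j) k / Real.sqrt (1 - lam j k ^ 2)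

/-- `F(x) = −2x(28x² + 33)/(9(4x² − 1)³)` (Eq. (4.13) of the paper). -/
def Ffun (x : ℝ) : ℝ := -(2 * x * (28 * x ^ 2 + 33)) / (9 * (4 * x ^ 2 - 1) ^ 3)

lemma Aconst_sq : Aconst ^ 2 = 243 / 343 := by
  rw [Aconst, div_pow, mul_pow, mul_pow, Real.sq_sqrt (by norm_num), Real.sq_sqrt (by norm_num)]
  norm_num

lemma lam_amplitude : 2 * Real.sqrt 7 / (3 * Real.sqrt 3) = 98 / 81 * Aconst := by
  have h3 : Real.sqrt 3 ^ 2 = 3 := Real.sq_sqrt (by norm_num)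
  have h7 : Real.sqrt 7 ^ 2 = 7 := Real.sq_sqrt (by norm_num)
  rw [Aconst]
  field_simp
  rw [h3, h7]
  norm_num

lemma lam_eq (j : ℕ) (k : ℝ) : lam j k = 98 / 81 * Aconst * Real.cos (xi j k) := by
  rw [lam, lam_amplitude]

lemma lam_sq (j : ℕ) (k : ℝ) : lam j k ^ 2 = 28 / 27 * Real.cos (xi j k) ^ 2 := by
  rw [lam_eq, mul_pow, mul_pow, Aconst_sq]
  norm_num

lemma Aconst_mul_cos_sq_lt_one (k : ℝ) : (Aconst * Real.cos k) ^ 2 < 1 := by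
  rw [mul_pow, Aconst_sq]
  linarith [Real.cos_sq_le_one k]

lemma three_mul_xi (j : ℕ) (k : ℝ) :
    3 * xi j k = Real.arccos (Aconst * Real.cos k) + j * (2 * Real.pi) := by
  rw [xi]
  ring

lemma cos_three_mul_xi (j : ℕ) (k : ℝ) : Real.cos (3 * xi j k) = Aconst * Real.cos k := by
  have h := abs_lt.1 ((sq_lt_one_iff_abs_lt_one _).1 (Aconst_mul_cos_sq_lt_one k))
  rw [three_mul_xi, Real.cos_add_nat_mul_two_pi, Real.cos_arccos h.1.le h.2.le]

lemma sin_three_mul_xi (j : ℕ) (k : ℝ) :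
    Real.sin (3 * xi j k) = Real.sqrt (1 - (Aconst * Real.cos k) ^ 2) := by
  rw [three_mul_xi, Real.sin_add_nat_mul_two_pi, Real.sin_arccos]

lemma four_mul_cos_xi_sq_ne_one (j : ℕ) (k : ℝ) : 4 * Real.cos (xi j k) ^ 2 ≠ 1 := by
  intro h
  have h1 := Aconst_mul_cos_sq_lt_one k
  rw [← cos_three_mul_xi j, Real.cos_three_mul] at h1
  have h2 : (4 * Real.cos (xi j k) ^ 3 - 3 * Real.cos (xi j k)) ^ 2
      = Real.cos (xi j k) ^ 2 * (4 * Real.cos (xi j k) ^ 2 - 3) ^ 2 := by ring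
  rw [h2, h] at h1
  linarith

lemma lam_cubic (j : ℕ) (k : ℝ) : 9 * lam j k ^ 3 - 7 * lam j k = 2 * Real.cos k := by
  have h := cos_three_mul_xi j k
  rw [Real.cos_three_mul] at h
  have hA := Aconst_sq
  rw [pow_succ, lam_sq, lam_eq]
  linear_combination (686 / 243 * Aconst) * h + (686 / 243 * Real.cos k) * hA

lemma twentySeven_mul_lam_sq_sub_seven_ne_zero (j : ℕ) (k : ℝ) : 27 * lam j k ^ 2 - 7 ≠ 0 := by
  rw [lam_sq]
  intro h
  exact four_mul_cos_xi_sq_ne_one j k (by linarith)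

lemma hasDerivAt_lam (j : ℕ) (k : ℝ) :
    HasDerivAt (lam j) (-(2 * Real.sin k) / (27 * lam j k ^ 2 - 7)) k := by
  have hlt := Aconst_mul_cos_sq_lt_one k
  have h := abs_lt.1 ((sq_lt_one_iff_abs_lt_one _).1 hlt)
  have hxi : HasDerivAt (xi j) (1 / 3 *
      (-(1 / Real.sqrt (1 - (Aconst * Real.cos k) ^ 2)) * (Aconst * -Real.sin k))) k :=
    (((Real.hasDerivAt_arccos h.1.ne' h.2.ne).comp k
      ((Real.hasDerivAt_cos k).const_mul Aconst)).const_mul (1 / 3)).add_const _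
  have hl := hxi.cos.const_mul (2 * Real.sqrt 7 / (3 * Real.sqrt 3))
  refine hl.congr_deriv ?_
  have hpos : Real.sin (3 * xi j k) ≠ 0 := by
    rw [sin_three_mul_xi]
    exact (Real.sqrt_pos.2 (by linarith)).ne'
  have hfac : Real.sin (3 * xi j k)
      = Real.sin (xi j k) * (4 * Real.cos (xi j k) ^ 2 - 1) := by
    rw [Real.sin_three_mul, Real.cos_sq']
    ring
  rw [← sin_three_mul_xi j, lam_amplitude, lam_sq, hfac]
  rw [hfac] at hpos
  have hs := left_ne_zero_of_mul hpos
  have hw := right_ne_zero_of_mul hpos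
  have hw' : 27 * (28 / 27 * Real.cos (xi j k) ^ 2) - 7
      = 7 * (4 * Real.cos (xi j k) ^ 2 - 1) := by ring
  rw [hw']
  field_simp
  rw [Aconst_sq]
  ring

lemma four_mul_sin_sq_eq (j : ℕ) (k : ℝ) :
    4 * Real.sin k ^ 2
      = (1 - lam j k ^ 2) * (9 * lam j k ^ 2 - 1) * (9 * lam j k ^ 2 - 4) := by
  linear_combination 4 * Real.sin_sq_add_cos_sq k
    + (2 * Real.cos k + 9 * lam j k ^ 3 - 7 * lam j k) * lam_cubic j k

lemma lam_sq_lt_one (j : ℕ) {k : ℝ} (hk : Real.sin k ≠ 0) : lam j k ^ 2 < 1 := by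
  by_contra! h
  have hs : 0 < 4 * Real.sin k ^ 2 := by positivity
  rw [four_mul_sin_sq_eq j, mul_assoc] at hs
  nlinarith [mul_pos (show 0 < 9 * lam j k ^ 2 - 1 by linarith)
    (show 0 < 9 * lam j k ^ 2 - 4 by linarith)]

lemma hasDerivAt_xfun (j l : ℕ) {k : ℝ} (hk : Real.sin k ≠ 0) :
    HasDerivAt (xfun j l)
      ((-1) ^ l * (9 * lam j k * (9 * lam j k ^ 2 + 11) / (27 * lam j k ^ 2 - 7) ^ 3
        * Real.sqrt (1 - lam j k ^ 2))) k := by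
  have hx : xfun j l = fun y ↦ (-1) ^ l * (-(2 * Real.sin y) / (27 * lam j y ^ 2 - 7))
      / Real.sqrt (1 - lam j y ^ 2) := by
    funext y
    rw [xfun, (hasDerivAt_lam j y).deriv]
  have hpos : 0 < 1 - lam j k ^ 2 := sub_pos.2 (lam_sq_lt_one j hk)
  have hw := twentySeven_mul_lam_sq_sub_seven_ne_zero j k
  have hr := (Real.sqrt_pos.2 hpos).ne'
  have hl := hasDerivAt_lam j k
  have hd := ((((((Real.hasDerivAt_sin k).const_mul 2).fun_neg).fun_div
    (((hl.fun_pow 2).const_mul 27).sub_const 7) hw).const_mul ((-1) ^ l)).fun_div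
    (((hl.fun_pow 2).const_sub 1).sqrt hpos.ne') hr)
  rw [hx]
  refine hd.congr_deriv ?_
  have hsin := four_mul_sin_sq_eq j k
  have hcos := lam_cubic j k
  have hsq := Real.sq_sqrt hpos.le
  clear hd hl hx
  generalize Real.sqrt (1 - lam j k ^ 2) = r at *
  generalize lam j k = t at *
  generalize Real.sin k = s at *
  generalize Real.cos k = c at *
  field_simp
  have hr4 : r ^ 4 = (1 - t ^ 2) ^ 2 := by rw [← hsq]; ring
  rw [hr4, hsq]
  push_cast
  linear_combination ((27 * t ^ 2 - 7) ^ 2 * (1 - t ^ 2)) * hcos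
    + (t * (27 * t ^ 2 - 7) - 54 * t * (1 - t ^ 2)) * hsin

/-- Eq. (4.10) of the paper. For `cos k ∉ {−1,1}`,
`4cos²ξ_j(k) ≠ 1`, `x_{j,l}` is differentiable at `k`, and
`dx_{j,l}/dk = −(−1)^l (A/21) F(cos ξ_j(k)) √(1 − (28/27)cos²ξ_j(k))`. -/
theorem xfun_deriv_formula (k : ℝ) (hk1 : Real.cos k ≠ 1) (hk2 : Real.cos k ≠ -1) :
    ∀ j < 3, ∀ l < 2,
      4 * Real.cos (xi j k) ^ 2 ≠ 1 ∧
      DifferentiableAt ℝ (xfun j l) k ∧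
      deriv (xfun j l) k =
        -(-1 : ℝ) ^ l * (Aconst / 21) * Ffun (Real.cos (xi j k)) *
          Real.sqrt (1 - (28 / 27) * Real.cos (xi j k) ^ 2) := by
  have hk : Real.sin k ≠ 0 := fun h ↦
    (Real.sin_eq_zero_iff_cos_eq.1 h).elim hk1 hk2
  intro j _ l _
  have hd := hasDerivAt_xfun j l hk
  refine ⟨four_mul_cos_xi_sq_ne_one j k, hd.differentiableAt, ?_⟩
  rw [hd.deriv, lam_sq, lam_eq, Ffun]
  have hw : 27 * (28 / 27 * Real.cos (xi j k) ^ 2) - 7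
      = 7 * (4 * Real.cos (xi j k) ^ 2 - 1) := by ring
  have hne : 4 * Real.cos (xi j k) ^ 2 - 1 ≠ 0 :=
    sub_ne_zero.2 (four_mul_cos_xi_sq_ne_one j k)
  rw [hw]
  field_simp
  ring
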